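/- (Generic rank with respect to the Grassmannian.) Let 1 ≤ d ≤ n, set N := d*(n−d)+1, and let m ≥ 1. Then: (a) if the m-th secant variety σ_m Gr(d,n) equals all of ℂ^Λ, then m * N ≥ choose n d; and (b) if m * N ≥ choose n d + N^2, then σ_m Gr(d,n) equals all of ℂ^Λ. -/

import Mathlib

noncomputable section

/-- The Zariski topology on `ι → ℂ`: a set is closed iff it is the common zero locus
of a family of polynomials in `MvPolynomial ι ℂ`. -/
def zt (ι : Type*) : TopologicalSpace (ι → ℂ) :=
  TopologicalSpace.generateFrom
    { U | ∃ f : MvPolynomial ι ℂ, U = { x | MvPolynomial.eval x f ≠ 0 } }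

def zIsOpen {ι : Type*} (S : Set (ι → ℂ)) : Prop := @IsOpen _ (zt ι) S

def zClosure {ι : Type*} (S : Set (ι → ℂ)) : Set (ι → ℂ) := @closure _ (zt ι) S

/-- The topological Krull dimension of `S` (with the subspace Zariski topology). -/
def zDim {ι : Type*} (S : Set (ι → ℂ)) : WithBot ℕ∞ :=
  @topologicalKrullDim ↥S (TopologicalSpace.induced Subtype.val (zt ι))

/-- The `m`-th secant variety: the Zariski closure of the set of sums of `m` points of `V`. -/
def secant {ι : Type*} (m : ℕ) (V : Set (ι → ℂ)) : Set (ι → ℂ) :=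
  zClosure { p | ∃ x : Fin m → (ι → ℂ), (∀ i, x i ∈ V) ∧ p = ∑ i, x i }

/-- The index type `Λ` of `d`-element subsets of `{0, …, n-1}`; `ℂ^Λ` carries the
Plücker coordinates. -/
def Lam (n d : ℕ) : Type := { S : Finset (Fin n) // S.card = d }

/-- The point of `ℂ^Λ` whose `S`-coordinate is the maximal minor of `M` with row set `S`
(rows taken in increasing order). -/
def plucker {n d : ℕ} (M : Matrix (Fin n) (Fin d) ℂ) : Lam n d → ℂ :=
  fun S => (M.submatrix (fun i : Fin d => ((S.1.orderIsoOfFin S.2) i : Fin n)) id).det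

/-- The affine cone over the Grassmannian in its Plücker embedding: the Zariski closure
of the set of all maximal-minor vectors of `n × d` matrices. -/
def GrassCone (n d : ℕ) : Set (Lam n d → ℂ) :=
  zClosure { p | ∃ M : Matrix (Fin n) (Fin d) ℂ, p = plucker M }

open Module

section PolynomialFunctions

variable {σ τ Λ : Type*}

/-- The algebra of polynomial functions on `σ → ℂ`. -/
def polyFun (σ : Type*) : Subalgebra ℂ ((σ → ℂ) → ℂ) :=
  (MvPolynomial.aeval (fun (i : σ) (x : σ → ℂ) => x i)).range

theorem aeval_coord_apply (p : MvPolynomial σ ℂ) (x : σ → ℂ) :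
    MvPolynomial.aeval (fun (i : σ) (x : σ → ℂ) => x i) p x = MvPolynomial.eval x p := by
  induction p using MvPolynomial.induction_on with
  | C a => simp
  | add p q hp hq => simp [hp, hq]
  | mul_X p i hp => simp [hp]

theorem mem_polyFun_iff {f : (σ → ℂ) → ℂ} :
    f ∈ polyFun σ ↔ ∃ p : MvPolynomial σ ℂ, ∀ x, f x = MvPolynomial.eval x p := by
  constructor
  · rintro ⟨p, rfl⟩
    exact ⟨p, fun x => aeval_coord_apply p x⟩
  · rintro ⟨p, hp⟩
    exact ⟨p, funext fun x => (aeval_coord_apply p x).trans (hp x).symm⟩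

theorem coord_mem_polyFun (i : σ) : (fun x : σ → ℂ => x i) ∈ polyFun σ :=
  mem_polyFun_iff.2 ⟨MvPolynomial.X i, by simp⟩

theorem const_mem_polyFun (c : ℂ) : (fun _ : σ → ℂ => c) ∈ polyFun σ :=
  mem_polyFun_iff.2 ⟨MvPolynomial.C c, by simp⟩

theorem sum_mem_polyFun {κ : Type*} (s : Finset κ) {f : κ → (σ → ℂ) → ℂ}
    (hf : ∀ k ∈ s, f k ∈ polyFun σ) : (fun x => ∑ k ∈ s, f k x) ∈ polyFun σ := by
  have h := Subalgebra.sum_mem (polyFun σ) hf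
  rwa [show ∑ k ∈ s, f k = fun x => ∑ k ∈ s, f k x by ext x; simp] at h

theorem prod_mem_polyFun {κ : Type*} (s : Finset κ) {f : κ → (σ → ℂ) → ℂ}
    (hf : ∀ k ∈ s, f k ∈ polyFun σ) : (fun x => ∏ k ∈ s, f k x) ∈ polyFun σ := by
  have h := Subalgebra.prod_mem (polyFun σ) hf
  rwa [show ∏ k ∈ s, f k = fun x => ∏ k ∈ s, f k x by ext x; simp] at h

theorem det_mem_polyFun {κ : Type*} [Fintype κ] [DecidableEq κ]
    {f : (σ → ℂ) → Matrix κ κ ℂ} (hf : ∀ i j, (fun x => f x i j) ∈ polyFun σ) :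
    (fun x => (f x).det) ∈ polyFun σ := by
  simp only [Matrix.det_apply']
  exact sum_mem_polyFun _ fun g _ => Subalgebra.mul_mem _ (const_mem_polyFun _)
    (prod_mem_polyFun _ fun i _ => hf _ _)

theorem eval_mem_polyFun (P : MvPolynomial Λ ℂ) {f : (σ → ℂ) → Λ → ℂ}
    (hf : ∀ l, (fun x => f x l) ∈ polyFun σ) :
    (fun x => MvPolynomial.eval (f x) P) ∈ polyFun σ := by
  induction P using MvPolynomial.induction_on with
  | C a => simpa using const_mem_polyFun a
  | add p q hp hq =>
    simp only [map_add]
    exact Subalgebra.add_mem _ hp hq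
  | mul_X p i hp =>
    simp only [map_mul, MvPolynomial.eval_X]
    exact Subalgebra.mul_mem _ hp (hf i)

theorem polyFun_mul_ne_zero {f g : (σ → ℂ) → ℂ} (hf : f ∈ polyFun σ) (hg : g ∈ polyFun σ)
    (hf0 : f ≠ 0) (hg0 : g ≠ 0) : f * g ≠ 0 := by
  obtain ⟨p, hp⟩ := mem_polyFun_iff.1 hf
  obtain ⟨q, hq⟩ := mem_polyFun_iff.1 hg
  have hp0 : p ≠ 0 := by
    rintro rfl
    exact hf0 (funext fun x => by simp [hp])
  have hq0 : q ≠ 0 := by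
    rintro rfl
    exact hg0 (funext fun x => by simp [hq])
  intro h
  refine mul_ne_zero hp0 hq0 (MvPolynomial.funext fun x => ?_)
  simpa [hp, hq] using congrFun h x

/-- The filter of subsets of `σ → ℂ` containing the nonvanishing locus of a nonzero polynomial
function. -/
def generic (σ : Type*) : Filter (σ → ℂ) where
  sets := {s | ∃ f ∈ polyFun σ, f ≠ 0 ∧ ∀ x, f x ≠ 0 → x ∈ s}
  univ_sets := ⟨1, Subalgebra.one_mem _, one_ne_zero, fun _ _ => trivial⟩
  sets_of_superset := by
    rintro s t ⟨f, hf, hf0, h⟩ hst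
    exact ⟨f, hf, hf0, fun x hx => hst (h x hx)⟩
  inter_sets := by
    rintro s t ⟨f, hf, hf0, h⟩ ⟨g, hg, hg0, h'⟩
    refine ⟨f * g, Subalgebra.mul_mem _ hf hg, polyFun_mul_ne_zero hf hg hf0 hg0, fun x hx => ?_⟩
    exact ⟨h x (left_ne_zero_of_mul hx), h' x (right_ne_zero_of_mul hx)⟩

theorem eventually_generic_iff {P : (σ → ℂ) → Prop} :
    (∀ᶠ x in generic σ, P x) ↔ ∃ f ∈ polyFun σ, f ≠ 0 ∧ ∀ x, f x ≠ 0 → P x :=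
  Iff.rfl

instance : (generic σ).NeBot := by
  refine ⟨fun h => ?_⟩
  obtain ⟨f, -, hf0, h⟩ := (Filter.empty_mem_iff_bot.2 h : (∅ : Set (σ → ℂ)) ∈ generic σ)
  exact hf0 (funext fun x => by_contra fun hx => h x hx)

theorem eventually_generic_ne_zero {f : (σ → ℂ) → ℂ} (hf : f ∈ polyFun σ) {x₀ : σ → ℂ}
    (h : f x₀ ≠ 0) : ∀ᶠ x in generic σ, f x ≠ 0 :=
  ⟨f, hf, fun h0 => h (by simp [h0]), fun _ hx => hx⟩

theorem eq_zero_of_eventually_generic {f : (σ → ℂ) → ℂ} (hf : f ∈ polyFun σ)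
    (h : ∀ᶠ x in generic σ, f x = 0) (x : σ → ℂ) : f x = 0 := by
  by_contra hx
  obtain ⟨y, hy, hy'⟩ := (h.and (eventually_generic_ne_zero hf hx)).exists
  exact hy' hy

/-- A generic property remains generic in a subset of the variables for some choice of the
others. -/
theorem exists_eventually_generic_extend {P : (σ → ℂ) → Prop} (h : ∀ᶠ z in generic σ, P z)
    {u : τ → σ} (hu : Function.Injective u) :
    ∃ z : σ → ℂ, ∀ᶠ y in generic τ, P (Function.extend u y z) := by
  obtain ⟨f, hf, hf0, h⟩ := eventually_generic_iff.1 h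
  obtain ⟨z, hz⟩ := Function.ne_iff.1 hf0
  obtain ⟨p, hp⟩ := mem_polyFun_iff.1 hf
  have hpoly : (fun y : τ → ℂ => f (Function.extend u y z)) ∈ polyFun τ := by
    simp only [hp]
    refine eval_mem_polyFun p fun l => ?_
    by_cases hl : ∃ i, u i = l
    · obtain ⟨i, rfl⟩ := hl
      simpa only [hu.extend_apply] using coord_mem_polyFun i
    · simpa only [Function.extend_apply' _ _ _ hl] using const_mem_polyFun (z l)
  have hz' : Function.extend u (z ∘ u) z = z := by
    ext l
    by_cases hl : ∃ i, u i = l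
    · obtain ⟨i, rfl⟩ := hl
      simp [hu.extend_apply]
    · simp [Function.extend_apply' _ _ _ hl]
  refine ⟨z, (eventually_generic_ne_zero hpoly (x₀ := z ∘ u) ?_).mono fun y hy => h _ hy⟩
  rwa [hz']

/-- The rank of a polynomial family of vectors is lower semicontinuous. -/
theorem eventually_finrank_span_le [Finite Λ] {κ : Type*} [Finite κ]
    {w : κ → (σ → ℂ) → Λ → ℂ} (hw : ∀ k l, (fun x => w k x l) ∈ polyFun σ) (x₀ : σ → ℂ) :
    ∀ᶠ x in generic σ, finrank ℂ (Submodule.span ℂ (Set.range fun k => w k x₀)) ≤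
      finrank ℂ (Submodule.span ℂ (Set.range fun k => w k x)) := by
  classical
  have := Fintype.ofFinite Λ
  obtain ⟨κ', a, ha, hspan, hli⟩ := exists_linearIndependent' ℂ (fun k => w k x₀)
  have : Finite κ' := Finite.of_injective a ha
  have := Fintype.ofFinite κ'
  obtain ⟨g, hg⟩ := LinearMap.exists_leftInverse_of_injective
    (Fintype.linearCombination ℂ ((fun k => w k x₀) ∘ a))
    (LinearMap.ker_eq_bot.2 (linearIndependent_iff_injective_fintypeLinearCombination.1 hli))
  have hg' : ∀ i, g (w (a i) x₀) = Pi.single i 1 := fun i => by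
    have := LinearMap.congr_fun hg (Pi.single i 1)
    simpa [Fintype.linearCombination_apply_single] using this
  have hdet : (fun x => (Matrix.of fun i j => g (w (a i) x) j).det) ∈ polyFun σ := by
    refine det_mem_polyFun fun i j => ?_
    have : ∀ x, g (w (a i) x) j = ∑ l, w (a i) x l * g (Pi.single l 1) j := fun x => by
      conv_lhs => rw [pi_eq_sum_univ' (w (a i) x)]
      simp [map_sum, Finset.sum_apply]
    simp only [Matrix.of_apply, this]
    exact sum_mem_polyFun _ fun l _ => Subalgebra.mul_mem _ (hw _ _) (const_mem_polyFun _)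
  have hdet₀ : (Matrix.of fun i j => g (w (a i) x₀) j).det ≠ 0 := by
    have : (Matrix.of fun i j => g (w (a i) x₀) j) = (1 : Matrix κ' κ' ℂ) := by
      ext i j
      simp [hg', Matrix.one_apply, Pi.single_apply, eq_comm]
    simp [this]
  filter_upwards [eventually_generic_ne_zero hdet hdet₀] with x hx
  have hli' : LinearIndependent ℂ (fun i => w (a i) x) :=
    LinearIndependent.of_comp g (Matrix.linearIndependent_rows_of_det_ne_zero hx)
  rw [← hspan, finrank_span_eq_card hli, ← finrank_span_eq_card hli']
  refine Submodule.finrank_mono (Submodule.span_mono ?_)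
  rintro _ ⟨i, rfl⟩
  exact ⟨a i, rfl⟩

end PolynomialFunctions

section ZariskiClosure

variable {ι : Type*}

theorem eval_eq_zero_of_mem_zClosure {S : Set (ι → ℂ)} {P : MvPolynomial ι ℂ}
    (hP : ∀ x ∈ S, MvPolynomial.eval x P = 0) {x : ι → ℂ} (hx : x ∈ zClosure S) :
    MvPolynomial.eval x P = 0 := by
  by_contra hne
  let _ := zt ι
  have hopen : IsOpen {x : ι → ℂ | MvPolynomial.eval x P ≠ 0} :=
    TopologicalSpace.isOpen_generateFrom_of_mem ⟨P, rfl⟩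
  obtain ⟨y, hy, hyS⟩ := mem_closure_iff.1 hx _ hopen hne
  exact hy (hP y hyS)

theorem subset_zClosure (S : Set (ι → ℂ)) : S ⊆ zClosure S :=
  @subset_closure _ (zt ι) S

theorem zClosure_eq_univ {S : Set (ι → ℂ)}
    (h : ∀ P : MvPolynomial ι ℂ, (∀ x ∈ S, MvPolynomial.eval x P = 0) → P = 0) :
    zClosure S = Set.univ := by
  let _ := zt ι
  have hbasis : TopologicalSpace.IsTopologicalBasis
      {U : Set (ι → ℂ) | ∃ f : MvPolynomial ι ℂ, U = {x | MvPolynomial.eval x f ≠ 0}} := by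
    refine ⟨?_, ?_, rfl⟩
    · rintro _ ⟨f, rfl⟩ _ ⟨g, rfl⟩ x hx
      exact ⟨_, ⟨f * g, rfl⟩, by simpa using hx, fun y hy => by simpa using hy⟩
    · exact Set.eq_univ_of_forall fun x => ⟨_, ⟨1, rfl⟩, by simp⟩
  refine Set.eq_univ_of_forall fun x => hbasis.mem_closure_iff.2 ?_
  rintro _ ⟨f, rfl⟩ hx
  by_contra hempty
  have hf : f = 0 := h f fun y hy => by_contra fun hne => hempty ⟨y, hne, hy⟩
  exact hx (by simp [hf])

end ZariskiClosure

section Plucker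

variable {n d : ℕ}

instance : Fintype (Lam n d) := inferInstanceAs (Fintype {S : Finset (Fin n) // S.card = d})

instance : DecidableEq (Lam n d) :=
  inferInstanceAs (DecidableEq {S : Finset (Fin n) // S.card = d})

theorem card_Lam (n d : ℕ) : Fintype.card (Lam n d) = n.choose d :=
  (Fintype.card_finset_len d).trans (by simp)

/-- The increasing enumeration of the elements of `S`. -/
def rows (S : Lam n d) (i : Fin d) : Fin n := S.1.orderIsoOfFin S.2 i

theorem plucker_apply (M : Matrix (Fin n) (Fin d) ℂ) (S : Lam n d) :
    plucker M S = (M.submatrix (rows S) id).det := rfl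

theorem rows_mem (S : Lam n d) (i : Fin d) : rows S i ∈ S.1 := (S.1.orderIsoOfFin S.2 i).2

theorem rows_injective (S : Lam n d) : Function.Injective (rows S) := fun _ _ h =>
  (S.1.orderIsoOfFin S.2).injective (Subtype.ext h)

theorem image_rows (S : Lam n d) : Finset.univ.image (rows S) = S.1 :=
  Finset.eq_of_subset_of_card_le (by simp [Finset.image_subset_iff, rows_mem])
    (by rw [Finset.card_image_of_injective _ (rows_injective S)]; simp [S.2])

theorem plucker_mul (M : Matrix (Fin n) (Fin d) ℂ) (B : Matrix (Fin d) (Fin d) ℂ) :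
    plucker (M * B) = B.det • plucker M := by
  ext S
  rw [Pi.smul_apply, smul_eq_mul, plucker_apply, plucker_apply,
    ← Matrix.submatrix_mul_equiv M B (rows S) (Equiv.refl _) id, Matrix.det_mul, mul_comm]
  rfl

theorem submatrix_updateCol (M : Matrix (Fin n) (Fin d) ℂ) (b : Fin d) (h : Fin n → ℂ)
    (f : Fin d → Fin n) :
    (M.updateCol b h).submatrix f id = (M.submatrix f id).updateCol b (h ∘ f) := by
  ext i k
  simp [Matrix.updateCol_apply]

/-- Replacing a column, as a linear map to the space of Plücker coordinates. -/
def pluckerUpdateCol (M : Matrix (Fin n) (Fin d) ℂ) (b : Fin d) :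
    (Fin n → ℂ) →ₗ[ℂ] (Lam n d → ℂ) where
  toFun h := plucker (M.updateCol b h)
  map_add' h h' := by
    ext S
    simp only [plucker_apply, submatrix_updateCol, Pi.add_apply, Pi.add_comp]
    exact Matrix.det_updateCol_add _ _ _ _
  map_smul' c h := by
    ext S
    simp only [plucker_apply, submatrix_updateCol, Pi.smul_apply, RingHom.id_apply, Pi.smul_comp]
    exact Matrix.det_updateCol_smul _ _ _ _

/-- The partial derivative of the Plücker map at `M` in the direction of a matrix entry. -/
def tanVec (M : Matrix (Fin n) (Fin d) ℂ) (k : Fin d × Fin n) : Lam n d → ℂ :=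
  plucker (M.updateCol k.1 (Pi.single k.2 1))

/-- The image of the differential of the Plücker map at `M`. -/
def tangent (M : Matrix (Fin n) (Fin d) ℂ) : Submodule ℂ (Lam n d → ℂ) :=
  Submodule.span ℂ (Set.range (tanVec M))

theorem plucker_updateCol_mem_tangent (M : Matrix (Fin n) (Fin d) ℂ) (b : Fin d)
    (h : Fin n → ℂ) : plucker (M.updateCol b h) ∈ tangent M := by
  change pluckerUpdateCol M b h ∈ tangent M
  rw [pi_eq_sum_univ' h, map_sum]
  refine Submodule.sum_mem _ fun a _ => ?_
  rw [map_smul]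
  exact Submodule.smul_mem _ _ (Submodule.subset_span ⟨(b, a), rfl⟩)

theorem plucker_updateCol_add_smul (M : Matrix (Fin n) (Fin d) ℂ) (b : Fin d) (h : Fin n → ℂ)
    (t : ℂ) : plucker (M.updateCol b (M.col b + t • h)) =
      plucker M + t • plucker (M.updateCol b h) := by
  have := (pluckerUpdateCol M b).map_add (M.col b) (t • h)
  rw [map_smul] at this
  refine this.trans (congrArg (· + _) (congrArg plucker ?_))
  ext i k
  by_cases hk : k = b <;> simp [hk]

/-- `ψ` is an injective linear map realizing left multiplication by `g` on Plücker coordinates. -/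
def Intertwines (g : Matrix (Fin n) (Fin n) ℂ)
    (ψ : (Lam n d → ℂ) →ₗ[ℂ] (Lam n d → ℂ)) : Prop :=
  Function.Injective ψ ∧ ∀ M : Matrix (Fin n) (Fin d) ℂ, plucker (g * M) = ψ (plucker M)

theorem Intertwines.map_tangent_le {g : Matrix (Fin n) (Fin n) ℂ}
    {ψ : (Lam n d → ℂ) →ₗ[ℂ] (Lam n d → ℂ)} (hψ : Intertwines g ψ)
    (M : Matrix (Fin n) (Fin d) ℂ) : (tangent M).map ψ ≤ tangent (g * M) := by
  rw [tangent, Submodule.map_span_le]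
  rintro _ ⟨⟨b, a⟩, rfl⟩
  rw [tanVec, ← hψ.2]
  convert plucker_updateCol_mem_tangent (g * M) b (g.mulVec (Pi.single a 1)) using 2
  ext i k
  by_cases hk : k = b
  · subst hk
    simp [Matrix.mul_apply, Pi.single_apply]
  · simp [Matrix.mul_apply, hk]

theorem plucker_diagonal_mul (ε : Fin n → ℂ) (M : Matrix (Fin n) (Fin d) ℂ) (S : Lam n d) :
    plucker (Matrix.diagonal ε * M) S = (∏ a ∈ S.1, ε a) * plucker M S := by
  rw [plucker_apply, plucker_apply, ← image_rows S,
    Finset.prod_image fun _ _ _ _ h => rows_injective S h, ← Matrix.det_mul_column]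
  congr 1
  ext i j
  simp [Matrix.diagonal_mul]

/-- Changing the sign of the coordinates indexed by sets containing `a`. -/
def flipSign (a : Fin n) : (Lam n d → ℂ) →ₗ[ℂ] (Lam n d → ℂ) where
  toFun v S := (if a ∈ S.1 then -1 else 1) * v S
  map_add' v w := by ext S; simp [mul_add]
  map_smul' c v := by ext S; simp

theorem flipSign_apply (a : Fin n) (v : Lam n d → ℂ) (S : Lam n d) :
    flipSign a v S = (if a ∈ S.1 then -1 else 1) * v S := rfl

/-- The diagonal matrix with entry `-1` at `a` and `1` elsewhere. -/
def flipMatrix (a : Fin n) : Matrix (Fin n) (Fin n) ℂ :=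
  Matrix.diagonal fun i => if a = i then -1 else 1

theorem flipMatrix_mul_self (a : Fin n) : flipMatrix a * flipMatrix a = 1 := by
  rw [flipMatrix, Matrix.diagonal_mul_diagonal, ← Matrix.diagonal_one]
  congr 1
  ext i
  split_ifs <;> simp

theorem intertwines_flip (a : Fin n) :
    Intertwines (flipMatrix a) (flipSign a : (Lam n d → ℂ) →ₗ[ℂ] _) := by
  refine ⟨fun v w h => ?_, fun M => ?_⟩
  · ext S
    have := congrFun h S
    rw [flipSign_apply, flipSign_apply] at this
    refine mul_left_cancel₀ ?_ this
    split_ifs <;> simp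
  · ext S
    rw [flipMatrix, plucker_diagonal_mul, flipSign_apply, Finset.prod_ite_eq]

/-- The action of permutations on index sets. -/
def permLam (π : Equiv.Perm (Fin n)) (S : Lam n d) : Lam n d :=
  ⟨S.1.map π.toEmbedding, by rw [Finset.card_map, S.2]⟩

theorem exists_plucker_submatrix_perm (π : Equiv.Perm (Fin n)) (S : Lam n d) :
    ∃ ε : ℂ, ε ≠ 0 ∧ ∀ M : Matrix (Fin n) (Fin d) ℂ,
      plucker (M.submatrix π id) S = ε * plucker M (permLam π S) := by
  have hmem : ∀ i, ∃ j, rows (permLam π S) j = π (rows S i) := fun i => by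
    have : π (rows S i) ∈ Finset.univ.image (rows (permLam π S)) := by
      rw [image_rows]
      exact Finset.mem_map_of_mem _ (rows_mem S i)
    simpa using this
  choose f hf using hmem
  have hinj : Function.Injective f := fun i j h => by
    apply rows_injective S
    apply π.injective
    rw [← hf, ← hf, h]
  let e := Equiv.ofBijective f (Finite.injective_iff_bijective.1 hinj)
  refine ⟨(Equiv.Perm.sign e : ℤ), ?_, fun M => ?_⟩
  · exact_mod_cast (Equiv.Perm.sign e).ne_zero
  · rw [plucker_apply, plucker_apply, ← Matrix.det_permute]
    congr 1
    ext i j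
    simp [e, hf]

theorem exists_intertwines_perm (π : Equiv.Perm (Fin n)) :
    ∃ (ψ : (Lam n d → ℂ) →ₗ[ℂ] (Lam n d → ℂ)) (ε : Lam n d → ℂ), (∀ S, ε S ≠ 0) ∧
      (∀ v S, ψ v S = ε S * v (permLam π S)) ∧
      Intertwines ((1 : Matrix (Fin n) (Fin n) ℂ).submatrix π id) ψ := by
  choose ε hε h using fun S : Lam n d => exists_plucker_submatrix_perm π S
  refine ⟨{ toFun := fun v S => ε S * v (permLam π S)
            map_add' := fun v w => by ext S; simp [mul_add]
            map_smul' := fun c v => by ext S; simp [mul_left_comm] }, ε, hε, fun v S => rfl,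
    fun v w hvw => ?_, fun M => ?_⟩
  · ext S
    have hS : permLam π (permLam π.symm S) = S := by
      apply Subtype.ext
      ext a
      simp [permLam]
    have := congrFun hvw (permLam π.symm S)
    simpa [hε, hS] using this
  · ext S
    change _ = ε S * _
    rw [← h]
    congr 1
    ext i j
    simp [Matrix.mul_apply, Matrix.one_apply]

theorem exists_permLam_eq (S T : Lam n d) : ∃ π : Equiv.Perm (Fin n), permLam π S = T := by
  have e : {a // a ∈ S.1} ≃ {a // a ∈ T.1} :=
    Fintype.equivOfCardEq (by simp [S.2, T.2])
  refine ⟨e.extendSubtype, Subtype.ext ?_⟩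
  refine Finset.eq_of_subset_of_card_le (fun a ha => ?_) ?_
  · obtain ⟨b, hb, rfl⟩ := Finset.mem_map.1 ha
    exact e.extendSubtype_mem b hb
  · rw [(permLam _ S).2, T.2]

/-- The exterior power is irreducible under sign changes and permutations of the basis. -/
theorem eq_top_of_intertwines_stable {F : Submodule ℂ (Lam n d → ℂ)} (hF : F ≠ ⊥)
    (hstab : ∀ (g g' : Matrix (Fin n) (Fin n) ℂ) (ψ ψ' : (Lam n d → ℂ) →ₗ[ℂ] (Lam n d → ℂ)),
      g * g' = 1 → Intertwines g ψ → Intertwines g' ψ' → ∀ v ∈ F, ψ v ∈ F) : F = ⊤ := by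
  obtain ⟨v, hv, hv0⟩ := F.exists_mem_ne_zero_of_ne_bot hF
  obtain ⟨S, hS⟩ := Function.ne_iff.1 hv0
  have hflip : ∀ (a : Fin n), ∀ w ∈ F, flipSign a w ∈ F := fun a =>
    hstab _ _ _ _ (flipMatrix_mul_self a) (intertwines_flip a) (intertwines_flip a)
  have hrestrict : ∀ A : Finset (Fin n),
      (fun T : Lam n d => if ∀ a ∈ A, (a ∈ T.1 ↔ a ∈ S.1) then v T else 0) ∈ F := by
    intro A
    induction A using Finset.induction_on with
    | empty => simpa using hv
    | insert a A _ ih =>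
      have := F.smul_mem (2⁻¹ : ℂ) (F.add_mem ih
        (F.smul_mem (if a ∈ S.1 then -1 else 1 : ℂ) (hflip a _ ih)))
      convert this using 1
      ext T
      simp only [Finset.forall_mem_insert, Pi.smul_apply, Pi.add_apply, flipSign_apply,
        smul_eq_mul, ite_and]
      generalize (if ∀ a ∈ A, (a ∈ T.1 ↔ a ∈ S.1) then v T else 0) = q
      by_cases h1 : a ∈ S.1 <;> by_cases h2 : a ∈ T.1 <;> simp [h1, h2] <;> ring
  have hsingle : Pi.single S 1 ∈ F := by
    have := F.smul_mem (v S)⁻¹ (hrestrict Finset.univ)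
    convert this using 1
    ext T
    by_cases hT : T = S
    · subst hT
      simpa using (inv_mul_cancel₀ hS).symm
    · have : ¬ ∀ a, (a ∈ T.1 ↔ a ∈ S.1) := fun h => hT (Subtype.ext (Finset.ext h))
      simp [hT, this]
  have hsingle' : ∀ T : Lam n d, Pi.single T (1 : ℂ) ∈ F := by
    intro T
    obtain ⟨π, hπ⟩ := exists_permLam_eq T S
    obtain ⟨ψ, ε, hε, hψ, hψi⟩ := exists_intertwines_perm (d := d) π
    obtain ⟨ψ', -, -, -, hψi'⟩ := exists_intertwines_perm (d := d) π.symm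
    have hmul : (1 : Matrix (Fin n) (Fin n) ℂ).submatrix π id *
        (1 : Matrix (Fin n) (Fin n) ℂ).submatrix π.symm id = 1 := by
      ext i j
      simp only [Matrix.mul_apply, Matrix.submatrix_apply, Matrix.one_apply, ite_mul, one_mul,
        zero_mul, id, Finset.sum_ite_eq]
      simp
    have := F.smul_mem (ε T)⁻¹ (hstab _ _ _ _ hmul hψi hψi' _ hsingle)
    convert this using 1
    ext R
    rw [Pi.smul_apply, hψ, smul_eq_mul]
    by_cases hR : R = T
    · subst hR
      simp [hπ, hε]
    · have : permLam π R ≠ S := fun h => hR (Subtype.ext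
        (Finset.map_injective _ (congrArg Subtype.val (h.trans hπ.symm))))
      simp [hR, this]
  refine eq_top_iff.2 fun w _ => ?_
  rw [pi_eq_sum_univ' w]
  exact F.sum_mem fun T _ => F.smul_mem _ (hsingle' T)

end Plucker

section SecantRank

variable {n d : ℕ} {ι : Type*}

/-- The family of matrices with the given entries. -/
def mats (x : ι × Fin n × Fin d → ℂ) (i : ι) : Matrix (Fin n) (Fin d) ℂ :=
  Matrix.of fun a b => x (i, a, b)

theorem exists_mats_eq (s : ι → Matrix (Fin n) (Fin d) ℂ) : ∃ x, mats x = s :=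
  ⟨fun p => s p.1 p.2.1 p.2.2, rfl⟩

theorem plucker_mats_mem_polyFun (i : ι) (S : Lam n d) :
    (fun x => plucker (mats x i) S) ∈ polyFun (ι × Fin n × Fin d) :=
  det_mem_polyFun fun _ _ => coord_mem_polyFun _

theorem tanVec_mats_mem_polyFun (i : ι) (k : Fin d × Fin n) (S : Lam n d) :
    (fun x => tanVec (mats x i) k S) ∈ polyFun (ι × Fin n × Fin d) := by
  refine det_mem_polyFun fun a b => ?_
  by_cases hb : b = k.1
  · simpa [Matrix.updateCol_apply, hb] using const_mem_polyFun _
  · simpa [Matrix.updateCol_apply, hb, mats] using coord_mem_polyFun _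

/-- The sum of the tangent spaces at the matrices indexed by `A`. -/
def tanSum (A : Finset ι) (s : ι → Matrix (Fin n) (Fin d) ℂ) : Submodule ℂ (Lam n d → ℂ) :=
  A.sup fun i => tangent (s i)

theorem tanSum_sup_span_eq (A : Finset ι) (s : ι → Matrix (Fin n) (Fin d) ℂ)
    (v : Lam n d → ℂ) :
    tanSum A s ⊔ Submodule.span ℂ {v} = Submodule.span ℂ (Set.range fun o : Option (A × _) =>
      o.elim v fun p => tanVec (s p.1) p.2) := by
  apply le_antisymm
  · refine sup_le (Finset.sup_le fun i hi => Submodule.span_le.2 ?_) (Submodule.span_mono ?_)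
    · rintro _ ⟨k, rfl⟩
      exact Submodule.subset_span ⟨some (⟨i, hi⟩, k), rfl⟩
    · rintro _ rfl
      exact ⟨none, rfl⟩
  · rw [Submodule.span_le]
    rintro _ ⟨_ | ⟨i, k⟩, rfl⟩
    · exact Submodule.mem_sup_right (Submodule.mem_span_singleton_self v)
    · exact Submodule.mem_sup_left (Finset.le_sup (f := fun i => tangent (s i)) i.2
        (Submodule.subset_span ⟨k, rfl⟩))

theorem eventually_finrank_tanSum_sup_le (A : Finset ι) (v : Lam n d → ℂ)
    (x₀ : ι × Fin n × Fin d → ℂ) :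
    ∀ᶠ x in generic (ι × Fin n × Fin d),
      finrank ℂ ↥(tanSum A (mats x₀) ⊔ Submodule.span ℂ {v}) ≤
        finrank ℂ ↥(tanSum A (mats x) ⊔ Submodule.span ℂ {v}) := by
  rw [tanSum_sup_span_eq]
  conv in finrank ℂ _ ≤ _ => rw [tanSum_sup_span_eq A (mats x)]
  refine eventually_finrank_span_le (κ := Option (A × Fin d × Fin n))
    (w := fun o x => o.elim v fun p => tanVec (mats x (p.1 : ι)) p.2) ?_ x₀
  rintro (_ | ⟨i, k⟩) S
  · exact const_mem_polyFun _
  · exact tanVec_mats_mem_polyFun _ _ _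

variable (n d) in
/-- The maximal dimension of a sum of `j` tangent spaces. -/
def secRank (j : ℕ) : ℕ :=
  sSup (Set.range fun s : Fin j → Matrix (Fin n) (Fin d) ℂ =>
    finrank ℂ (tanSum Finset.univ s))

theorem bddAbove_finrank_tanSum (j : ℕ) :
    BddAbove (Set.range fun s : Fin j → Matrix (Fin n) (Fin d) ℂ =>
      finrank ℂ (tanSum Finset.univ s)) := by
  refine ⟨finrank ℂ (Lam n d → ℂ), ?_⟩
  rintro _ ⟨s, rfl⟩
  exact Submodule.finrank_le _

theorem exists_finrank_tanSum_eq_secRank (j : ℕ) :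
    ∃ s : Fin j → Matrix (Fin n) (Fin d) ℂ,
      finrank ℂ (tanSum Finset.univ s) = secRank n d j :=
  Nat.sSup_mem (Set.range_nonempty _) (bddAbove_finrank_tanSum j)

theorem finrank_tanSum_univ_le {j : ℕ} (s : Fin j → Matrix (Fin n) (Fin d) ℂ) :
    finrank ℂ (tanSum Finset.univ s) ≤ secRank n d j :=
  le_csSup (bddAbove_finrank_tanSum j) ⟨s, rfl⟩

theorem tanSum_map {κ : Type*} (A : Finset κ) (f : κ ↪ ι)
    (s : ι → Matrix (Fin n) (Fin d) ℂ) : tanSum (A.map f) s = tanSum A (s ∘ f) :=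
  Finset.sup_map _ _ _

theorem exists_univ_map_eq (A : Finset ι) :
    ∃ f : Fin A.card ↪ ι, Finset.univ.map f = A := by
  refine ⟨A.equivFin.symm.toEmbedding.trans (Function.Embedding.subtype _), ?_⟩
  ext i
  simp only [Finset.mem_map, Finset.mem_univ, true_and]
  exact ⟨fun ⟨k, hk⟩ => hk ▸ (A.equivFin.symm k).2, fun hi => ⟨A.equivFin ⟨i, hi⟩, by simp⟩⟩

theorem finrank_tanSum_le (A : Finset ι) (s : ι → Matrix (Fin n) (Fin d) ℂ) :
    finrank ℂ (tanSum A s) ≤ secRank n d A.card := by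
  obtain ⟨f, hf⟩ := exists_univ_map_eq A
  conv_lhs => rw [← hf, tanSum_map]
  exact finrank_tanSum_univ_le _

theorem exists_finrank_tanSum_eq (A : Finset ι) :
    ∃ s : ι → Matrix (Fin n) (Fin d) ℂ, finrank ℂ (tanSum A s) = secRank n d A.card := by
  obtain ⟨f, hf⟩ := exists_univ_map_eq A
  obtain ⟨s, hs⟩ := exists_finrank_tanSum_eq_secRank (n := n) (d := d) A.card
  refine ⟨Function.extend f s 0, ?_⟩
  have h : tanSum A (Function.extend f s 0) =
      tanSum (Finset.univ.map f) (Function.extend f s 0) := by rw [hf]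
  rw [h, tanSum_map, Function.extend_comp f.injective, hs]

theorem eventually_finrank_tanSum_eq (A : Finset ι) :
    ∀ᶠ x in generic (ι × Fin n × Fin d),
      finrank ℂ (tanSum A (mats x)) = secRank n d A.card := by
  obtain ⟨s, hs⟩ := exists_finrank_tanSum_eq (n := n) (d := d) A
  obtain ⟨x₀, rfl⟩ := exists_mats_eq s
  filter_upwards [eventually_finrank_tanSum_sup_le A 0 x₀] with x hx
  rw [Submodule.span_zero_singleton, sup_bot_eq, sup_bot_eq, hs] at hx
  exact le_antisymm (finrank_tanSum_le A _) hx

theorem secRank_le (j : ℕ) : secRank n d j ≤ n.choose d := by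
  obtain ⟨s, hs⟩ := exists_finrank_tanSum_eq_secRank (n := n) (d := d) j
  rw [← hs, ← card_Lam, ← Module.finrank_pi ℂ]
  exact Submodule.finrank_le _

theorem secRank_mono : Monotone (secRank n d) := by
  refine monotone_nat_of_le_succ fun j => ?_
  obtain ⟨s, hs⟩ := exists_finrank_tanSum_eq (n := n) (d := d) (Finset.range j)
  have h := finrank_tanSum_le (Finset.range (j + 1)) s
  rw [Finset.card_range] at hs h
  rw [← hs]
  exact (Submodule.finrank_mono (Finset.sup_mono (by simp))).trans h

theorem secRank_concave (j : ℕ) :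
    secRank n d (j + 2) + secRank n d j ≤ 2 * secRank n d (j + 1) := by
  obtain ⟨x, h0, h1, h2, h3⟩ := ((eventually_finrank_tanSum_eq (n := n) (d := d)
    (Finset.range j)).and ((eventually_finrank_tanSum_eq (insert j (Finset.range j))).and
    ((eventually_finrank_tanSum_eq (insert (j + 1) (Finset.range j))).and
    (eventually_finrank_tanSum_eq (insert (j + 1) (insert j (Finset.range j))))))).exists
  have hj : j + 1 ∉ Finset.range j := by simp
  rw [Finset.card_range] at h0
  rw [Finset.card_insert_of_notMem Finset.notMem_range_self, Finset.card_range] at h1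
  rw [Finset.card_insert_of_notMem hj, Finset.card_range] at h2
  rw [Finset.card_insert_of_notMem (by simp), Finset.card_insert_of_notMem
    Finset.notMem_range_self, Finset.card_range, add_assoc, one_add_one_eq_two] at h3
  have hsum := Submodule.finrank_sup_add_finrank_inf_eq
    (tanSum (insert j (Finset.range j)) (mats x)) (tanSum (insert (j + 1) (Finset.range j)) (mats x))
  have hsup : tanSum (insert j (Finset.range j)) (mats x) ⊔
      tanSum (insert (j + 1) (Finset.range j)) (mats x) =
      tanSum (insert (j + 1) (insert j (Finset.range j))) (mats x) := by
    simp only [tanSum, Finset.sup_insert]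
    rw [sup_comm, sup_assoc, sup_left_comm (Finset.sup _ _), sup_idem]
  have hinf : tanSum (Finset.range j) (mats x) ≤
      tanSum (insert j (Finset.range j)) (mats x) ⊓
        tanSum (insert (j + 1) (Finset.range j)) (mats x) :=
    le_inf (Finset.sup_mono (Finset.subset_insert _ _))
      (Finset.sup_mono (Finset.subset_insert _ _))
  have := Submodule.finrank_mono hinf
  rw [hsup] at hsum
  omega

/-- If the dimension of a sum of subspaces depends only on the number of summands, through a
function whose increments at `j` and `j + 1` agree, then the intersection of one of the subspaces
with the sum of `j` others does not depend on the choice of the others. -/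
theorem inf_sup_eq_of_increment_eq {V : Type*} [AddCommGroup V] [Module ℂ V]
    [FiniteDimensional ℂ V] [DecidableEq ι] {T : ι → Submodule ℂ V} {ρ : ℕ → ℕ}
    (hρ : ∀ A : Finset ι, finrank ℂ ↥(A.sup T) = ρ A.card) {j : ℕ}
    (hj : ρ (j + 2) + ρ j = 2 * ρ (j + 1)) {y : ι} {A B : Finset ι} (hA : A.card = j)
    (hB : B.card = j) (hyA : y ∉ A) (hyB : y ∉ B) : T y ⊓ A.sup T = T y ⊓ B.sup T := by
  have hdim : ∀ C : Finset ι, y ∉ C →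
      ρ (C.card + 1) + finrank ℂ ↥(T y ⊓ C.sup T) = ρ 1 + ρ C.card := fun C hC => by
    have h := Submodule.finrank_sup_add_finrank_inf_eq (T y) (C.sup T)
    rw [← Finset.sup_insert, hρ, hρ, Finset.card_insert_of_notMem hC] at h
    have hy := hρ {y}
    rw [Finset.sup_singleton, Finset.card_singleton] at hy
    rwa [hy] at h
  have hins : ∀ C : Finset ι, C.card = j → y ∉ C → ∀ b, b ∉ C → b ≠ y →
      T y ⊓ C.sup T = T y ⊓ (insert b C).sup T := fun C hC hyC b hb hby => by
    refine Submodule.eq_of_le_of_finrank_eq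
      (inf_le_inf_left _ (Finset.sup_mono (Finset.subset_insert _ _))) ?_
    have h1 := hdim C hyC
    have h2 := hdim (insert b C) (by simp [hyC, hby.symm])
    rw [Finset.card_insert_of_notMem hb] at h2
    rw [hC] at h1 h2
    rw [show j + 1 + 1 = j + 2 from rfl] at h2
    omega
  induction h : (A \ B).card generalizing A with
  | zero =>
    have hAB : A ⊆ B := by simpa [Finset.card_eq_zero, Finset.sdiff_eq_empty_iff_subset] using h
    rw [Finset.eq_of_subset_of_card_le hAB (by omega)]
  | succ k ih =>
    obtain ⟨a, ha⟩ := Finset.card_pos.1 (by omega : 0 < (A \ B).card)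
    have hBA : (B \ A).card = (A \ B).card := by
      rw [Finset.card_sdiff_comm (hB.trans hA.symm)]
    obtain ⟨b, hb⟩ := Finset.card_pos.1 (by omega : 0 < (B \ A).card)
    rw [Finset.mem_sdiff] at ha hb
    have hby : b ≠ y := fun h => hyB (h ▸ hb.1)
    have hay : a ≠ y := fun h => hyA (h ▸ ha.1)
    have hab : a ≠ b := fun h => hb.2 (h ▸ ha.1)
    have hcard : (insert b (A.erase a)).card = j := by
      rw [Finset.card_insert_of_notMem (by simp [hb.2]), Finset.card_erase_of_mem ha.1]
      have := Finset.card_pos.2 ⟨a, ha.1⟩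
      omega
    have hyA' : y ∉ insert b (A.erase a) := by simp [hyA, hby.symm]
    have hswap : insert a (insert b (A.erase a)) = insert b A := by
      rw [Finset.insert_comm, Finset.insert_erase ha.1]
    rw [hins A hA hyA b hb.2 hby, ← hswap, ← hins _ hcard hyA' a (by simp [hab]) hay]
    refine ih hcard hyA' ?_
    have : insert b (A.erase a) \ B = (A \ B).erase a := by
      ext c
      simp only [Finset.mem_sdiff, Finset.mem_insert, Finset.mem_erase]
      constructor
      · rintro ⟨rfl | h, h'⟩
        · exact absurd hb.1 h'
        · exact ⟨h.1, h.2, h'⟩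
      · rintro ⟨h1, h2, h3⟩
        exact ⟨Or.inr ⟨h1, h2⟩, h3⟩
    rw [this, Finset.card_erase_of_mem (Finset.mem_sdiff.2 ha)]
    omega

variable (n d) in
/-- The intersection of all sums of `j` tangent spaces of maximal dimension. -/
def commonTan (j : ℕ) : Submodule ℂ (Lam n d → ℂ) :=
  ⨅ (s : Fin j → Matrix (Fin n) (Fin d) ℂ)
    (_ : finrank ℂ (tanSum Finset.univ s) = secRank n d j), tanSum Finset.univ s

theorem mem_commonTan {j : ℕ} {v : Lam n d → ℂ} :
    v ∈ commonTan n d j ↔ ∀ s : Fin j → Matrix (Fin n) (Fin d) ℂ,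
      finrank ℂ (tanSum Finset.univ s) = secRank n d j → v ∈ tanSum Finset.univ s := by
  simp [commonTan, Submodule.mem_iInf]

theorem Intertwines.map_tanSum_le {g : Matrix (Fin n) (Fin n) ℂ}
    {ψ : (Lam n d → ℂ) →ₗ[ℂ] (Lam n d → ℂ)} (hψ : Intertwines g ψ) (A : Finset ι)
    (s : ι → Matrix (Fin n) (Fin d) ℂ) :
    (tanSum A s).map ψ ≤ tanSum A (fun i => g * s i) := by
  rw [Submodule.map_le_iff_le_comap]
  refine Finset.sup_le fun i hi => Submodule.map_le_iff_le_comap.1 ?_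
  exact (hψ.map_tangent_le (s i)).trans (Finset.le_sup (f := fun i => tangent (g * s i)) hi)

theorem commonTan_stable (j : ℕ) (g g' : Matrix (Fin n) (Fin n) ℂ)
    (ψ ψ' : (Lam n d → ℂ) →ₗ[ℂ] (Lam n d → ℂ)) (hg : g * g' = 1) (hψ : Intertwines g ψ)
    (hψ' : Intertwines g' ψ') : ∀ v ∈ commonTan n d j, ψ v ∈ commonTan n d j := by
  intro v hv
  rw [mem_commonTan] at hv ⊢
  intro s hs
  have hs' : finrank ℂ (tanSum Finset.univ fun i => g' * s i) = secRank n d j := by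
    refine le_antisymm (finrank_tanSum_univ_le _) ?_
    rw [← hs, (Submodule.equivMapOfInjective ψ' hψ'.1 _).finrank_eq]
    exact Submodule.finrank_mono (hψ'.map_tanSum_le _ s)
  have := hψ.map_tanSum_le _ _ (Submodule.mem_map_of_mem (hv _ hs'))
  simpa only [← Matrix.mul_assoc, hg, Matrix.one_mul] using this

theorem mem_commonTan_of_eventually {j : ℕ} {v : Lam n d → ℂ}
    (h : ∀ᶠ x in generic (Fin j × Fin n × Fin d), v ∈ tanSum Finset.univ (mats x)) :
    v ∈ commonTan n d j := by
  refine mem_commonTan.2 fun s hs => ?_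
  obtain ⟨x₀, rfl⟩ := exists_mats_eq s
  by_contra hv
  obtain ⟨x, hx, hx'⟩ := (h.and (eventually_finrank_tanSum_sup_le Finset.univ v x₀)).exists
  rw [sup_eq_left.2 ((Submodule.span_singleton_le_iff_mem _ _).2 hx)] at hx'
  have hlt : finrank ℂ (tanSum Finset.univ (mats x₀)) <
      finrank ℂ ↥(tanSum Finset.univ (mats x₀) ⊔ Submodule.span ℂ {v}) :=
    Submodule.finrank_lt_finrank_of_lt (left_lt_sup.2 fun hle =>
      hv ((Submodule.span_singleton_le_iff_mem _ _).1 hle))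
  have := finrank_tanSum_univ_le (mats x)
  omega

theorem exists_generic_inf_tanSum_eq {j : ℕ}
    (hj : secRank n d (j + 2) + secRank n d j = 2 * secRank n d (j + 1)) :
    ∃ E : Submodule ℂ (Lam n d → ℂ),
      secRank n d (j + 1) + finrank ℂ E = secRank n d 1 + secRank n d j ∧
      ∀ᶠ x in generic (Fin j × Fin n × Fin d), E ≤ tanSum Finset.univ (mats x) := by
  classical
  let u : Fin j × Fin n × Fin d → Option (Fin j ⊕ Fin j) × Fin n × Fin d :=
    fun p => (some (Sum.inr p.1), p.2)
  have hu : Function.Injective u := by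
    rintro ⟨i, c⟩ ⟨i', c'⟩ h
    simpa [u] using h
  obtain ⟨z, hz⟩ := exists_eventually_generic_extend (Filter.eventually_all.2
    fun A : Finset (Option (Fin j ⊕ Fin j)) => eventually_finrank_tanSum_eq (n := n) (d := d) A) hu
  let fl : Fin j ↪ Option (Fin j ⊕ Fin j) := Function.Embedding.inl.trans Function.Embedding.some
  let fr : Fin j ↪ Option (Fin j ⊕ Fin j) := Function.Embedding.inr.trans Function.Embedding.some
  have hleft : ∀ y i, mats (Function.extend u y z) (fl i) = mats z (fl i) := fun y i => by
    ext a b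
    refine Function.extend_apply' _ _ _ ?_
    simp [u, fl]
  have hnone : ∀ y, mats (Function.extend u y z) none = mats z none := fun y => by
    ext a b
    refine Function.extend_apply' _ _ _ ?_
    simp [u]
  have hright : ∀ y, mats (Function.extend u y z) ∘ fr = mats y := fun y => by
    ext i a b
    exact hu.extend_apply y z (i, a, b)
  have hsup : ∀ y, tanSum (Finset.univ.map fl) (mats (Function.extend u y z)) =
      tanSum (Finset.univ.map fl) (mats z) := fun y => by
    rw [tanSum_map, tanSum_map]
    congr 1
    exact funext (hleft y)
  refine ⟨tangent (mats z none) ⊓ tanSum (Finset.univ.map fl) (mats z), ?_, ?_⟩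
  · obtain ⟨y, hy⟩ := hz.exists
    have h1 := hy {none}
    have h2 := hy (Finset.univ.map fl)
    have h3 := hy (insert none (Finset.univ.map fl))
    rw [Finset.card_insert_of_notMem (by simp [fl])] at h3
    simp only [Finset.card_map, Finset.card_univ, Fintype.card_fin, Finset.card_singleton] at *
    rw [hsup] at h2
    rw [tanSum, Finset.sup_insert, hnone, ← tanSum, hsup] at h3
    rw [tanSum, Finset.sup_singleton, hnone] at h1
    rw [← h1, ← h2, ← h3]
    exact Submodule.finrank_sup_add_finrank_inf_eq _ _
  · filter_upwards [hz] with y hy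
    have h := inf_sup_eq_of_increment_eq (ρ := secRank n d) hy hj
      (y := none) (A := Finset.univ.map fl) (B := Finset.univ.map fr) (by simp) (by simp)
      (by simp [fl]) (by simp [fr])
    rw [hnone, ← tanSum, ← tanSum, hsup, tanSum_map _ fr, hright] at h
    rw [h]
    exact inf_le_right

/-- Once the increments of `secRank` are smaller than the first one, they decrease strictly until
the sums of tangent spaces fill the ambient space. -/
theorem secRank_eq_of_increment_eq {j : ℕ}
    (hj : secRank n d (j + 2) + secRank n d j = 2 * secRank n d (j + 1))
    (hlt : secRank n d (j + 1) < secRank n d j + secRank n d 1) :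
    secRank n d j = n.choose d := by
  obtain ⟨E, hE, hgen⟩ := exists_generic_inf_tanSum_eq hj
  have hle : E ≤ commonTan n d j := fun v hv =>
    mem_commonTan_of_eventually (hgen.mono fun x hx => hx hv)
  have hE0 : E ≠ ⊥ := by
    rintro rfl
    rw [finrank_bot] at hE
    omega
  have htop : commonTan n d j = ⊤ :=
    eq_top_of_intertwines_stable (fun h => hE0 (le_bot_iff.1 (h ▸ hle))) (commonTan_stable j)
  obtain ⟨s, hs⟩ := exists_finrank_tanSum_eq_secRank (n := n) (d := d) j
  have : tanSum Finset.univ s = ⊤ := by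
    rw [eq_top_iff, ← htop]
    exact fun v hv => mem_commonTan.1 hv s hs
  rw [← hs, this, finrank_top, Module.finrank_pi, card_Lam]

theorem secRank_eq_of_le {N m : ℕ} (hN : 1 ≤ N) (hN1 : N ≤ secRank n d 1)
    (hm : n.choose d + N ^ 2 ≤ m * N) : secRank n d m = n.choose d := by
  by_contra hne
  have hlt : ∀ j ≤ m, secRank n d j < n.choose d := fun j hj =>
    (secRank_mono hj).trans_lt (lt_of_le_of_ne (secRank_le m) hne)
  have hdec : ∀ j ≤ m, secRank n d (j + 1) < secRank n d j + N →
      secRank n d (j + 2) + secRank n d j < 2 * secRank n d (j + 1) := fun j hj h =>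
    lt_of_le_of_ne (secRank_concave j) fun heq =>
      (hlt j hj).ne (secRank_eq_of_increment_eq heq (by omega))
  have key : ∀ j ≤ m, j * N ≤ secRank n d j ∨ ∃ j₀ ≤ j, j₀ * N ≤ n.choose d ∧
      secRank n d (j + 1) + j + 1 ≤ secRank n d j + j₀ + N := by
    intro j
    induction j with
    | zero => simp
    | succ j ih =>
      intro hj
      have hd := hdec j (by omega)
      rcases ih (by omega) with h | ⟨j₀, hj₀, h0, h⟩
      · by_cases hN' : secRank n d (j + 1) < secRank n d j + N
        · right
          refine ⟨j, by omega, h.trans (secRank_le j), ?_⟩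
          have := hd hN'
          rw [show j + 1 + 1 = j + 2 from rfl]
          omega
        · left
          rw [add_mul]
          omega
      · right
        refine ⟨j₀, by omega, h0, ?_⟩
        have := hd (by omega)
        rw [show j + 1 + 1 = j + 2 from rfl]
        omega
  rcases key m le_rfl with h | ⟨j₀, -, h0, h⟩
  · have := secRank_le (n := n) (d := d) m
    have := hlt m le_rfl
    nlinarith
  · have := secRank_mono (n := n) (d := d) (Nat.le_add_right m 1)
    have h' : m + 1 ≤ j₀ + N := by omega
    nlinarith

end SecantRank

section TangentDimension

variable {n d : ℕ}

/-- The matrix whose `b`-th column is the standard basis vector with index `f b`. -/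
def selectMatrix (f : Fin d → Fin n) : Matrix (Fin n) (Fin d) ℂ :=
  Matrix.of fun a b => if a = f b then 1 else 0

theorem selectMatrix_updateCol (f : Fin d → Fin n) (b : Fin d) (a : Fin n) :
    (selectMatrix f).updateCol b (Pi.single a 1) = selectMatrix (Function.update f b a) := by
  ext i k
  by_cases hk : k = b
  · subst hk
    simp [selectMatrix, Pi.single_apply]
  · simp [selectMatrix, hk]

/-- The index set of the nonzero Plücker coordinate of `selectMatrix f`. -/
def imageLam (f : Fin d → Fin n) (hf : Function.Injective f) : Lam n d :=
  ⟨Finset.univ.image f, by simp [Finset.card_image_of_injective _ hf]⟩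

theorem exists_plucker_selectMatrix_eq (f : Fin d → Fin n) (hf : Function.Injective f) :
    ∃ c : ℂ, c ≠ 0 ∧ plucker (selectMatrix f) = c • Pi.single (imageLam f hf) 1 := by
  have hmem : ∀ i, ∃ j, f j = rows (imageLam f hf) i := fun i => by
    simpa [imageLam] using rows_mem (imageLam f hf) i
  choose e he using hmem
  have hinj : Function.Injective e := fun i j h =>
    rows_injective (imageLam f hf) (by rw [← he, ← he, h])
  let e' := Equiv.ofBijective e (Finite.injective_iff_bijective.1 hinj)
  refine ⟨(Equiv.Perm.sign e' : ℤ), by exact_mod_cast (Equiv.Perm.sign e').ne_zero, ?_⟩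
  ext S
  by_cases hS : S = imageLam f hf
  · subst hS
    have : (selectMatrix f).submatrix (rows (imageLam f hf)) id =
        (1 : Matrix (Fin d) (Fin d) ℂ).submatrix e' id := by
      ext i j
      simp [selectMatrix, ← he, hf.eq_iff, Matrix.one_apply, e']
    rw [plucker_apply, this, Matrix.det_permute]
    simp
  · have : ∃ k, f k ∉ S.1 := by
      by_contra! h
      refine hS (Subtype.ext (Finset.eq_of_subset_of_card_le ?_ ?_).symm)
      · simpa [imageLam, Finset.image_subset_iff] using h
      · rw [S.2, (imageLam f hf).2]
    obtain ⟨k, hk⟩ := this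
    rw [plucker_apply, Matrix.det_eq_zero_of_column_eq_zero k]
    · simp [hS]
    · intro i
      have : rows S i ≠ f k := fun h => hk (h ▸ rows_mem S i)
      simp [selectMatrix, this]

theorem le_secRank_one (hd : 1 ≤ d) (hdn : d ≤ n) : d * (n - d) + 1 ≤ secRank n d 1 := by
  let top : Fin d → Fin n := Fin.castLE hdn
  let bot : Fin (n - d) → Fin n := fun c => ⟨d + c, by omega⟩
  have hne : ∀ b c, top b ≠ bot c := fun b c h => by
    have := congrArg Fin.val h
    simp only [top, bot, Fin.val_castLE] at this
    omega
  have htop : Function.Injective top := Fin.castLE_injective hdn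
  have hbot : Function.Injective bot := fun c c' h => by
    have := congrArg Fin.val h
    simp only [bot] at this
    omega
  let f : Option (Fin d × Fin (n - d)) → Fin d → Fin n :=
    fun o => o.elim top fun p => Function.update top p.1 (bot p.2)
  have hf : ∀ o, Function.Injective (f o) := by
    rintro (_ | ⟨b, c⟩)
    · exact htop
    · intro k l h
      by_cases hk : k = b <;> by_cases hl : l = b
      · rw [hk, hl]
      · subst hk
        simp [f, hl, (hne l c).symm] at h
      · subst hl
        simp [f, hk, hne k c] at h
      · simpa [f, hk, hl, htop.eq_iff] using h
  have hinj : Function.Injective fun o => imageLam (f o) (hf o) := by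
    have himage : ∀ o o', imageLam (f o) (hf o) = imageLam (f o') (hf o') →
        ∀ k, ∃ l, f o' l = f o k := fun o o' h k => by
      have hk : f o k ∈ (imageLam (f o) (hf o)).1 := by simp [imageLam]
      rw [h] at hk
      simpa [imageLam] using hk
    have hbot_mem : ∀ b c o, imageLam (f (some (b, c))) (hf _) = imageLam (f o) (hf o) →
        ∃ b', o = some (b', c) := fun b c o h => by
      obtain ⟨l, hl⟩ := himage _ _ h b
      rcases o with _ | ⟨b', c'⟩
      · simp [f, hne] at hl
      · by_cases hlb : l = b'
        · subst hlb
          simp only [f, Option.elim, Function.update_self, hbot.eq_iff] at hl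
          exact ⟨l, by rw [hl]⟩
        · simp [f, hlb, hne] at hl
    rintro (_ | ⟨b, c⟩) o' h
    · rcases o' with _ | ⟨b', c'⟩
      · rfl
      · obtain ⟨_, h'⟩ := hbot_mem b' c' _ h.symm
        exact absurd h' (by simp)
    · obtain ⟨b', rfl⟩ := hbot_mem b c o' h
      by_cases hb : b = b'
      · rw [hb]
      · obtain ⟨l, hl⟩ := himage _ _ h.symm b
        by_cases hlb : l = b
        · subst hlb
          simp [f, hb, (hne _ _).symm] at hl
        · simp [f, hb, hlb, htop.eq_iff] at hl
  have hmem : ∀ o, Pi.single (imageLam (f o) (hf o)) 1 ∈ tangent (selectMatrix top) := by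
    intro o
    obtain ⟨c, hc, h⟩ := exists_plucker_selectMatrix_eq (f o) (hf o)
    have h' : plucker (selectMatrix (f o)) ∈ tangent (selectMatrix top) := by
      have hupd : ∃ b a, f o = Function.update top b a := by
        rcases o with _ | ⟨b, a⟩
        · exact ⟨⟨0, hd⟩, top ⟨0, hd⟩, (Function.update_eq_self _ _).symm⟩
        · exact ⟨b, bot a, rfl⟩
      obtain ⟨b, a, hba⟩ := hupd
      rw [hba, ← selectMatrix_updateCol]
      exact plucker_updateCol_mem_tangent _ _ _
    have := Submodule.smul_mem _ c⁻¹ h'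
    rwa [h, inv_smul_smul₀ hc] at this
  have hli : LinearIndependent ℂ
      fun o => (Pi.single (imageLam (f o) (hf o)) 1 : Lam n d → ℂ) := by
    have := (Pi.basisFun ℂ (Lam n d)).linearIndependent.comp _ hinj
    simpa [Function.comp_def] using this
  have hcard := finrank_span_eq_card hli
  have hle : finrank ℂ (tangent (selectMatrix top)) ≤ secRank n d 1 := by
    have h := finrank_tanSum_le Finset.univ fun _ : Unit => selectMatrix top
    rwa [tanSum, Finset.univ_unique, Finset.sup_singleton, Finset.card_singleton] at h
  calc d * (n - d) + 1 = Fintype.card (Option (Fin d × Fin (n - d))) := by simp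
    _ ≤ finrank ℂ (tangent (selectMatrix top)) := by
        rw [← hcard]
        refine Submodule.finrank_mono (Submodule.span_le.2 ?_)
        rintro _ ⟨o, rfl⟩
        exact hmem o
    _ ≤ secRank n d 1 := hle

end TangentDimension

section Derivatives

variable {Λ : Type*}

theorem totalDegree_pderiv_le {P : MvPolynomial Λ ℂ} {k : ℕ} (hP : P.totalDegree ≤ k + 1)
    (S : Λ) : (MvPolynomial.pderiv S P).totalDegree ≤ k := by
  refine Finset.sup_le fun e he => ?_
  rw [MvPolynomial.mem_support_iff, MvPolynomial.coeff_pderiv] at he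
  have h := (MvPolynomial.le_totalDegree
    (MvPolynomial.mem_support_iff.2 (left_ne_zero_of_mul he))).trans hP
  rw [Finsupp.sum_add_index' (fun _ => rfl) (fun _ _ _ => rfl),
    Finsupp.sum_single_index rfl] at h
  exact Nat.le_of_succ_le_succ h

theorem eq_C_of_pderiv_eq_zero {P : MvPolynomial Λ ℂ}
    (hP : ∀ S, MvPolynomial.pderiv S P = 0) : P = MvPolynomial.C (P.coeff 0) := by
  classical
  ext e
  rw [MvPolynomial.coeff_C]
  split_ifs with he
  · rw [he]
  · obtain ⟨S, hS⟩ : ∃ S, e S ≠ 0 := by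
      by_contra! h
      exact he (Finsupp.ext fun S => by simp [h])
    have h := MvPolynomial.coeff_pderiv (i := S) P (e - Finsupp.single S 1)
    rw [hP, MvPolynomial.coeff_zero, tsub_add_cancel_of_le
      (by simpa [Finsupp.single_le_iff] using Nat.one_le_iff_ne_zero.2 hS)] at h
    have h' := mul_eq_zero.1 h.symm
    exact h'.resolve_right (by norm_cast)

theorem derivative_aeval [Fintype Λ] (f : Λ → Polynomial ℂ) (P : MvPolynomial Λ ℂ) :
    Polynomial.derivative (MvPolynomial.aeval f P) =
      ∑ S, MvPolynomial.aeval f (MvPolynomial.pderiv S P) * Polynomial.derivative (f S) := by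
  classical
  induction P using MvPolynomial.induction_on with
  | C a => simp
  | add p q hp hq => simp [hp, hq, add_mul, Finset.sum_add_distrib]
  | mul_X p i hp =>
    have hS : ∀ S, MvPolynomial.aeval f (MvPolynomial.pderiv S (p * MvPolynomial.X i)) *
        Polynomial.derivative (f S) =
        MvPolynomial.aeval f (MvPolynomial.pderiv S p) * Polynomial.derivative (f S) * f i +
          if S = i then MvPolynomial.aeval f p * Polynomial.derivative (f S) else 0 := fun S => by
      rw [MvPolynomial.pderiv_mul, map_add, map_mul, map_mul, MvPolynomial.aeval_X]
      split_ifs with h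
      · rw [h, MvPolynomial.pderiv_X_self, map_one]
        ring
      · rw [MvPolynomial.pderiv_X_of_ne (Ne.symm h), map_zero]
        ring
    rw [Finset.sum_congr rfl fun S _ => hS S, Finset.sum_add_distrib, Finset.sum_ite_eq',
      if_pos (Finset.mem_univ _), ← Finset.sum_mul, ← hp, map_mul, MvPolynomial.aeval_X,
      Polynomial.derivative_mul]

theorem sum_pderiv_mul_eq_zero [Fintype Λ] {P : MvPolynomial Λ ℂ} {z w : Λ → ℂ}
    (h : ∀ t : ℂ, MvPolynomial.eval (z + t • w) P = 0) :
    ∑ S, MvPolynomial.eval z (MvPolynomial.pderiv S P) * w S = 0 := by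
  obtain ⟨f, hf⟩ : ∃ f : Λ → Polynomial ℂ,
      ∀ S, f S = Polynomial.C (z S) + Polynomial.X * Polynomial.C (w S) := ⟨_, fun _ => rfl⟩
  have heval : ∀ (t : ℂ) (Q : MvPolynomial Λ ℂ),
      (MvPolynomial.aeval f Q).eval t = MvPolynomial.eval (z + t • w) Q := fun t Q => by
    induction Q using MvPolynomial.induction_on with
    | C a => simp
    | add p q hp hq => simp [hp, hq]
    | mul_X p i hp => simp [hp, hf, mul_comm t]
  have hzero : MvPolynomial.aeval f P = 0 :=
    Polynomial.funext fun t => by rw [heval, h, Polynomial.eval_zero]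
  have hder := congrArg (Polynomial.eval 0) (derivative_aeval f P)
  rw [hzero, Polynomial.eval_finsetSum] at hder
  simpa [heval, hf] using hder.symm

end Derivatives

section Density

variable {n d m : ℕ}

theorem sum_plucker_update (s : Fin m → Matrix (Fin n) (Fin d) ℂ) (i : Fin m)
    (k : Fin d × Fin n) (t : ℂ) :
    ∑ j, plucker (Function.update s i
        ((s i).updateCol k.1 ((s i).col k.1 + t • Pi.single k.2 1)) j) =
      ∑ j, plucker (s j) + t • tanVec (s i) k := by
  rw [← Finset.add_sum_erase _ _ (Finset.mem_univ i),
    ← Finset.add_sum_erase _ (fun j => plucker (s j)) (Finset.mem_univ i),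
    Function.update_self, plucker_updateCol_add_smul, tanVec, add_right_comm]
  congr 1
  rw [Finset.sum_congr rfl fun j hj => ?_]
  rw [Function.update_of_ne (Finset.ne_of_mem_erase hj)]

theorem eval_pderiv_sum_plucker_eq_zero {P : MvPolynomial (Lam n d) ℂ}
    (hP : ∀ s : Fin m → Matrix (Fin n) (Fin d) ℂ,
      MvPolynomial.eval (∑ i, plucker (s i)) P = 0)
    (hm : secRank n d m = n.choose d) (S : Lam n d) (s : Fin m → Matrix (Fin n) (Fin d) ℂ) :
    MvPolynomial.eval (∑ i, plucker (s i)) (MvPolynomial.pderiv S P) = 0 := by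
  obtain ⟨x, rfl⟩ := exists_mats_eq s
  refine eq_zero_of_eventually_generic
    (f := fun x => MvPolynomial.eval (∑ i, plucker (mats x i)) (MvPolynomial.pderiv S P))
    (eval_mem_polyFun _ fun l => ?_) ?_ x
  · simp only [Finset.sum_apply]
    exact sum_mem_polyFun _ fun i _ => plucker_mats_mem_polyFun i l
  filter_upwards [eventually_finrank_tanSum_eq (n := n) (d := d) (Finset.univ : Finset (Fin m))]
    with x hx
  have htop : tanSum Finset.univ (mats x) = ⊤ := by
    refine Submodule.eq_top_of_finrank_eq ?_
    rw [hx, Finset.card_univ, Fintype.card_fin, hm, finrank_pi, card_Lam]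
  let φ : (Lam n d → ℂ) →ₗ[ℂ] ℂ := Fintype.linearCombination ℂ
    fun T => MvPolynomial.eval (∑ i, plucker (mats x i)) (MvPolynomial.pderiv T P)
  have hφ : tanSum Finset.univ (mats x) ≤ LinearMap.ker φ := by
    refine Finset.sup_le fun i _ => Submodule.span_le.2 ?_
    rintro _ ⟨k, rfl⟩
    have h := sum_pderiv_mul_eq_zero (P := P) (z := ∑ i, plucker (mats x i))
      (w := tanVec (mats x i) k) fun t => by rw [← sum_plucker_update, hP]
    simpa [φ, Fintype.linearCombination_apply, mul_comm] using h
  have hS : φ (Pi.single S 1) = 0 := hφ (htop ▸ Submodule.mem_top)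
  simpa [φ, Fintype.linearCombination_apply_single] using hS

theorem eq_zero_of_eval_sum_plucker (hm : secRank n d m = n.choose d) (k : ℕ) :
    ∀ P : MvPolynomial (Lam n d) ℂ, P.totalDegree ≤ k →
      (∀ s : Fin m → Matrix (Fin n) (Fin d) ℂ,
        MvPolynomial.eval (∑ i, plucker (s i)) P = 0) → P = 0 := by
  have hconst : ∀ (P : MvPolynomial (Lam n d) ℂ) (c : ℂ), P = MvPolynomial.C c →
      (∀ s : Fin m → Matrix (Fin n) (Fin d) ℂ,
        MvPolynomial.eval (∑ i, plucker (s i)) P = 0) → P = 0 := by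
    rintro _ c rfl h
    have := h 0
    rw [MvPolynomial.eval_C] at this
    rw [this, map_zero]
  induction k with
  | zero =>
    intro P hdeg h
    exact hconst P _ (MvPolynomial.totalDegree_eq_zero_iff_eq_C.1 (Nat.le_zero.1 hdeg)) h
  | succ k ih =>
    intro P hdeg h
    exact hconst P _ (eq_C_of_pderiv_eq_zero fun S => ih _ (totalDegree_pderiv_le hdeg S)
      (eval_pderiv_sum_plucker_eq_zero h hm S)) h

theorem plucker_mem_GrassCone (M : Matrix (Fin n) (Fin d) ℂ) : plucker M ∈ GrassCone n d :=
  subset_zClosure _ ⟨M, rfl⟩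

theorem secant_eq_univ_of_secRank_eq (hm : secRank n d m = n.choose d) :
    secant m (GrassCone n d) = Set.univ :=
  zClosure_eq_univ fun P hP => eq_zero_of_eval_sum_plucker hm _ P le_rfl fun s =>
    hP _ ⟨fun i => plucker (s i), fun i => plucker_mem_GrassCone (s i), rfl⟩

end Density

section DimensionBound

variable {ι : Type*}

theorem eval_sum_eq_zero_of_mem_zClosure {κ : Type*} [Fintype κ] {V : Set (ι → ℂ)}
    {P : MvPolynomial ι ℂ} (hP : ∀ v : κ → ι → ℂ, (∀ i, v i ∈ V) →
      MvPolynomial.eval (∑ i, v i) P = 0) {v : κ → ι → ℂ} (hv : ∀ i, v i ∈ zClosure V) :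
    MvPolynomial.eval (∑ i, v i) P = 0 := by
  classical
  suffices h : ∀ (A : Finset κ) (v : κ → ι → ℂ), (∀ i ∈ A, v i ∈ zClosure V) →
      (∀ i ∉ A, v i ∈ V) → MvPolynomial.eval (∑ i, v i) P = 0 from
    h Finset.univ v (fun i _ => hv i) fun i hi => (hi (Finset.mem_univ i)).elim
  intro A
  induction A using Finset.induction_on with
  | empty => exact fun v _ hv => hP v fun i => hv i (Finset.notMem_empty i)
  | insert a A ha ih =>
    intro v hA hnA
    let c := ∑ i ∈ Finset.univ.erase a, v i
    let Q : MvPolynomial ι ℂ :=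
      MvPolynomial.bind₁ (fun S => MvPolynomial.X S + MvPolynomial.C (c S)) P
    have hQ : ∀ u, MvPolynomial.eval u Q = MvPolynomial.eval (u + c) P := fun u => by
      simp only [Q, MvPolynomial.eval, MvPolynomial.eval₂Hom_bind₁]
      congr 2
      ext S
      simp
    rw [← Finset.add_sum_erase _ _ (Finset.mem_univ a), ← hQ]
    refine eval_eq_zero_of_mem_zClosure (fun u hu => ?_) (hA a (Finset.mem_insert_self a A))
    have hsum : u + c = ∑ i, Function.update v a u i := by
      rw [← Finset.add_sum_erase _ _ (Finset.mem_univ a), Function.update_self]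
      exact congrArg _ (Finset.sum_congr rfl fun i hi =>
        (Function.update_of_ne (Finset.ne_of_mem_erase hi) _ _).symm)
    rw [hQ, hsum]
    refine ih _ (fun i hi => ?_) fun i hi => ?_
    · rw [Function.update_of_ne (ne_of_mem_of_not_mem hi ha)]
      exact hA i (Finset.mem_insert_of_mem hi)
    · by_cases hia : i = a
      · rw [hia, Function.update_self]
        exact hu
      · rw [Function.update_of_ne hia]
        exact hnA i (by simp [hia, hi])

/-- The coordinates of a polynomial map to a space of larger dimension satisfy a polynomial
relation. -/
theorem exists_ne_zero_eval_eq_zero {τ Λ : Type*} [Fintype τ] [Fintype Λ]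
    (hcard : Fintype.card τ < Fintype.card Λ) {F : (τ → ℂ) → Λ → ℂ}
    (hF : ∀ S, (fun y => F y S) ∈ polyFun τ) :
    ∃ P : MvPolynomial Λ ℂ, P ≠ 0 ∧ ∀ y, MvPolynomial.eval (F y) P = 0 := by
  choose p hp using fun S => mem_polyFun_iff.1 (hF S)
  have hdep : ¬ AlgebraicIndependent ℂ p := fun h => by
    have h' := h.lift_cardinalMk_le_trdeg
    rw [MvPolynomial.trdeg_of_isDomain] at h'
    simp only [Cardinal.mk_fintype, Cardinal.lift_natCast, Nat.cast_le] at h'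
    omega
  rw [algebraicIndependent_iff] at hdep
  push Not at hdep
  obtain ⟨P, hP, hP0⟩ := hdep
  refine ⟨P, hP0, fun y => ?_⟩
  have h := congrArg (MvPolynomial.eval y) hP
  rw [map_zero, MvPolynomial.map_aeval, MvPolynomial.algebraMap_eq, MvPolynomial.eval,
    MvPolynomial.eval₂Hom_comp_C] at h
  rwa [show F y = fun S => MvPolynomial.eval y (p S) from funext fun S => hp S y]

variable {n d m : ℕ}

/-- The `d × d` matrix formed by the first `d` rows of `M`. -/
def topBlock (hdn : d ≤ n) (M : Matrix (Fin n) (Fin d) ℂ) : Matrix (Fin d) (Fin d) ℂ :=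
  M.submatrix (Fin.castLE hdn) id

/-- The matrix with first `d` rows the identity and remaining rows read off from `y`. -/
def chart (y : Fin m × Option (Fin d × Fin (n - d)) → ℂ) (i : Fin m) :
    Matrix (Fin n) (Fin d) ℂ :=
  Matrix.of fun a b => if h : (a : ℕ) < d then (if (a : ℕ) = b then 1 else 0)
    else y (i, some (b, ⟨a - d, by omega⟩))

theorem plucker_chart_mem_polyFun (i : Fin m) (S : Lam n d) :
    (fun y => plucker (chart y i) S) ∈ polyFun (Fin m × Option (Fin d × Fin (n - d))) := by
  refine det_mem_polyFun fun a b => ?_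
  simp only [Matrix.submatrix_apply, chart, Matrix.of_apply]
  split_ifs
  · exact const_mem_polyFun _
  · exact const_mem_polyFun _
  · exact coord_mem_polyFun _

theorem exists_chart_eq (hdn : d ≤ n) {s : Fin m → Matrix (Fin n) (Fin d) ℂ}
    (hs : ∀ i, (topBlock hdn (s i)).det ≠ 0) :
    ∃ y : Fin m × Option (Fin d × Fin (n - d)) → ℂ, ∀ i,
      y (i, none) • plucker (chart y i) = plucker (s i) := by
  let y : Fin m × Option (Fin d × Fin (n - d)) → ℂ := fun p => p.2.elim
    (topBlock hdn (s p.1)).det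
    fun k => (s p.1 * (topBlock hdn (s p.1))⁻¹) ⟨d + k.2, by omega⟩ k.1
  refine ⟨y, fun i => ?_⟩
  have hunit : IsUnit (topBlock hdn (s i)).det := (hs i).isUnit
  have hchart : chart y i = s i * (topBlock hdn (s i))⁻¹ := by
    ext a b
    by_cases ha : (a : ℕ) < d
    · have h := congrFun (congrFun (Matrix.mul_nonsing_inv _ hunit) ⟨a, ha⟩) b
      rw [Matrix.one_apply] at h
      simp only [chart, Matrix.of_apply, ha, dite_true]
      simpa [topBlock, Matrix.mul_apply, Fin.ext_iff, eq_comm] using h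
    · have : (⟨d + (a - d), by omega⟩ : Fin n) = a := Fin.ext (by simp; omega)
      simp only [chart, Matrix.of_apply, ha, dite_false, y, Option.elim, this]
  change (topBlock hdn (s i)).det • _ = _
  rw [← plucker_mul, hchart, Matrix.mul_assoc, Matrix.nonsing_inv_mul _ hunit, Matrix.mul_one]

theorem eventually_det_topBlock_ne_zero (hdn : d ≤ n) :
    ∀ᶠ x in generic (Fin m × Fin n × Fin d), ∀ i, (topBlock hdn (mats x i)).det ≠ 0 := by
  rw [Filter.eventually_all]
  intro i
  obtain ⟨x₀, hx₀⟩ := exists_mats_eq (fun _ : Fin m => (Matrix.of fun a b =>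
    if (a : ℕ) = b then 1 else 0 : Matrix (Fin n) (Fin d) ℂ))
  refine eventually_generic_ne_zero (x₀ := x₀)
    (det_mem_polyFun fun a b => coord_mem_polyFun _) ?_
  have : topBlock hdn (mats x₀ i) = 1 := by
    ext a b
    simp [hx₀, topBlock, Matrix.one_apply, Fin.ext_iff]
  simp [this]

theorem exists_ne_zero_eval_sum_plucker_eq_zero (hdn : d ≤ n)
    (h : m * (d * (n - d) + 1) < n.choose d) :
    ∃ P : MvPolynomial (Lam n d) ℂ, P ≠ 0 ∧ ∀ s : Fin m → Matrix (Fin n) (Fin d) ℂ,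
      MvPolynomial.eval (∑ i, plucker (s i)) P = 0 := by
  obtain ⟨P, hP0, hP⟩ := exists_ne_zero_eval_eq_zero
    (τ := Fin m × Option (Fin d × Fin (n - d))) (Λ := Lam n d)
    (F := fun y => ∑ i, y (i, none) • plucker (chart y i)) (by simpa [card_Lam] using h)
    fun S => by
      simp only [Finset.sum_apply, Pi.smul_apply, smul_eq_mul]
      exact sum_mem_polyFun _ fun i _ =>
        Subalgebra.mul_mem _ (coord_mem_polyFun _) (plucker_chart_mem_polyFun i S)
  refine ⟨P, hP0, fun s => ?_⟩
  obtain ⟨x, rfl⟩ := exists_mats_eq s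
  refine eq_zero_of_eventually_generic
    (f := fun x => MvPolynomial.eval (∑ i, plucker (mats x i)) P)
    (eval_mem_polyFun _ fun l => ?_) ?_ x
  · simp only [Finset.sum_apply]
    exact sum_mem_polyFun _ fun i _ => plucker_mats_mem_polyFun i l
  filter_upwards [eventually_det_topBlock_ne_zero hdn] with x hx
  obtain ⟨y, hy⟩ := exists_chart_eq hdn hx
  simpa only [hy] using hP y

theorem choose_le_of_secant_eq_univ (hdn : d ≤ n)
    (h : secant m (GrassCone n d) = Set.univ) : n.choose d ≤ m * (d * (n - d) + 1) := by
  by_contra! hlt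
  obtain ⟨P, hP0, hP⟩ := exists_ne_zero_eval_sum_plucker_eq_zero hdn hlt
  refine hP0 (MvPolynomial.funext fun z => ?_)
  rw [map_zero]
  refine eval_eq_zero_of_mem_zClosure (fun _ hx => ?_) (h ▸ Set.mem_univ z : z ∈ secant m _)
  obtain ⟨v, hv, rfl⟩ := hx
  refine eval_sum_eq_zero_of_mem_zClosure (fun u hu => ?_) hv
  choose s hs using hu
  simpa only [hs] using hP s

end DimensionBound

theorem stmt_9 (n d : ℕ) (hd : 1 ≤ d) (hdn : d ≤ n)
    (N : ℕ) (hN : N = d * (n - d) + 1)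
    (m : ℕ) (hm : 1 ≤ m) :
    (secant m (GrassCone n d) = Set.univ → Nat.choose n d ≤ m * N) ∧
    (Nat.choose n d + N ^ 2 ≤ m * N → secant m (GrassCone n d) = Set.univ) := by
  subst hN
  exact ⟨choose_le_of_secant_eq_univ hdn, fun h => secant_eq_univ_of_secRank_eq
    (secRank_eq_of_le (Nat.le_add_left 1 _) (le_secRank_one hd hdn) h)⟩
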